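/- Let m ≥ 0 be an integer and let a, b ∈ ℝ[t] be real polynomials of degree at most m. Then the function t ↦ a(t)·J₂(t) + b(t)·J₃(t) has at most 3m + 2 isolated zeros in the open interval (0, 1/64). -/

import Mathlib

open MeasureTheory Set Filter

/-- The region bounded by the real oval of `{x^2 y (1-x-y) = t}` in the first quadrant. -/
def Δset (t : ℝ) : Set (ℝ × ℝ) :=
  {z : ℝ × ℝ | 0 < z.1 ∧ 0 < z.2 ∧ t ≤ z.1 ^ 2 * z.2 * (1 - z.1 - z.2)}

/-- The Abelian integral `I_{i,j}(t) = ∬_{Δ(t)} x^i y^j dx dy` (integer powers). -/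
noncomputable def Iab (i j : ℤ) (t : ℝ) : ℝ :=
  ∫ z in Δset t, z.1 ^ i * z.2 ^ j

noncomputable def J1 (t : ℝ) : ℝ := Iab 0 0 t
noncomputable def J2 (t : ℝ) : ℝ := Iab 2 0 t
noncomputable def J3 (t : ℝ) : ℝ := Iab 3 0 t

/-- The function `√(1/2 - r (1 + sin² θ))`. -/
noncomputable def rootFactor (r θ : ℝ) : ℝ := √(1 / 2 - r * (1 + Real.sin θ ^ 2))

lemma radicand_pos {r : ℝ} (hr : r < 1 / 4) (θ : ℝ) :
    0 < 1 / 2 - r * (1 + Real.sin θ ^ 2) := by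
  nlinarith [Real.sin_sq_le_one θ]

lemma rootFactor_pos {r : ℝ} (hr : r < 1 / 4) (θ : ℝ) : 0 < rootFactor r θ :=
  Real.sqrt_pos.2 (radicand_pos hr θ)

lemma rootFactor_sq {r : ℝ} (hr : r < 1 / 4) (θ : ℝ) :
    rootFactor r θ ^ 2 = 1 / 2 - r * (1 + Real.sin θ ^ 2) :=
  Real.sq_sqrt (radicand_pos hr θ).le

lemma continuous_rootFactor (r : ℝ) : Continuous (rootFactor r) := by
  unfold rootFactor; fun_prop

lemma hasDerivAt_rootFactor_param {r : ℝ} (hr : r < 1 / 4) (θ : ℝ) :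
    HasDerivAt (fun r => rootFactor r θ) (-(1 + Real.sin θ ^ 2) / (2 * rootFactor r θ)) r := by
  have h := (((hasDerivAt_id r).mul_const (1 + Real.sin θ ^ 2)).const_sub (1 / 2)).sqrt
    (radicand_pos hr θ).ne'
  simpa [rootFactor] using h

lemma hasDerivAt_rootFactor_angle {r : ℝ} (hr : r < 1 / 4) (θ : ℝ) :
    HasDerivAt (rootFactor r) (-(r * Real.sin θ * Real.cos θ) / rootFactor r θ) θ := by
  have h : HasDerivAt (fun θ => √(1 / 2 - r * (1 + Real.sin θ ^ 2)))
      (-(r * (2 * Real.sin θ * Real.cos θ)) / (2 * √(1 / 2 - r * (1 + Real.sin θ ^ 2)))) θ := by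
    refine HasDerivAt.sqrt ?_ (radicand_pos hr θ).ne'
    exact (((((Real.hasDerivAt_sin θ).fun_pow 2).const_add 1).const_mul r).const_sub
      (1 / 2)).congr_deriv (by simp)
  have hp := rootFactor_pos hr θ
  refine h.congr_deriv ?_
  unfold rootFactor at hp ⊢
  field_simp

lemma hasDerivAt_integral_mul_rootFactor {φ : ℝ → ℝ} (hφ : Continuous φ) {r : ℝ}
    (hr : r < 1 / 4) :
    HasDerivAt (fun r => ∫ θ in -(Real.pi / 2)..Real.pi / 2, φ θ * rootFactor r θ)
      (∫ θ in -(Real.pi / 2)..Real.pi / 2, φ θ * (-(1 + Real.sin θ ^ 2) / (2 * rootFactor r θ)))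
      r := by
  obtain ⟨ρ, h, h2⟩ := exists_between (max_lt (by norm_num : (0 : ℝ) < 1 / 4) hr)
  obtain ⟨h0, h1⟩ := max_lt_iff.1 h
  have hpos : 0 < √(1 / 2 - ρ * 2) := Real.sqrt_pos.2 (by linarith)
  refine (intervalIntegral.hasDerivAt_integral_of_dominated_loc_of_deriv_le
    (s := Iio ρ) (bound := fun θ => |φ θ| * (2 / (2 * √(1 / 2 - ρ * 2))))
    (F' := fun r θ => φ θ * (-(1 + Real.sin θ ^ 2) / (2 * rootFactor r θ)))
    (Iio_mem_nhds h1) ?_ ?_ ?_ ?_ ?_ ?_).2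
  · exact .of_forall fun x => (hφ.mul (continuous_rootFactor x)).aestronglyMeasurable
  · exact (hφ.mul (continuous_rootFactor r)).intervalIntegrable _ _
  · refine Continuous.aestronglyMeasurable (hφ.mul (.div (by fun_prop)
      (continuous_const.mul (continuous_rootFactor r)) fun θ => ?_))
    have := rootFactor_pos hr θ
    positivity
  · refine .of_forall fun θ _ x hx => ?_
    have hx0 := rootFactor_pos (lt_trans hx h2) θ
    have hS := Real.sin_sq_le_one θ
    rw [norm_mul, Real.norm_eq_abs, Real.norm_eq_abs, abs_div, abs_neg,
      abs_of_pos (by positivity : 0 < 1 + Real.sin θ ^ 2),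
      abs_of_pos (by positivity : 0 < 2 * rootFactor x θ)]
    have : √(1 / 2 - ρ * 2) ≤ rootFactor x θ :=
      Real.sqrt_le_sqrt (by nlinarith [mem_Iio.1 hx, sq_nonneg (Real.sin θ)])
    gcongr
    linarith
  · exact (hφ.abs.mul continuous_const).intervalIntegrable _ _
  · exact .of_forall fun θ _ x hx =>
      (hasDerivAt_rootFactor_param (lt_trans hx h2) θ).const_mul (φ θ)

lemma continuous_div_rootFactor {φ : ℝ → ℝ} (hφ : Continuous φ) {r : ℝ} (hr : r < 1 / 4) :
    Continuous fun θ => φ θ / rootFactor r θ :=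
  hφ.div (continuous_rootFactor r) fun θ => (rootFactor_pos hr θ).ne'

/-- The total derivative of `sin θ ^ (2 k + 1) * cos θ * rootFactor r θ` with respect to `θ`. -/
noncomputable def exactForm (k : ℕ) (r θ : ℝ) : ℝ :=
  ((((2 * k + 1) * Real.sin θ ^ (2 * k) * Real.cos θ ^ 2 - Real.sin θ ^ (2 * k + 2)) *
    (1 / 2 - r * (1 + Real.sin θ ^ 2)) - r * Real.sin θ ^ (2 * k + 2) * Real.cos θ ^ 2) /
      rootFactor r θ)

lemma continuous_exactForm (k : ℕ) {r : ℝ} (hr : r < 1 / 4) : Continuous (exactForm k r) :=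
  continuous_div_rootFactor (by fun_prop) hr

lemma integral_exactForm (k : ℕ) {r : ℝ} (hr : r < 1 / 4) :
    ∫ θ in -(Real.pi / 2)..Real.pi / 2, exactForm k r θ = 0 := by
  rw [intervalIntegral.integral_eq_sub_of_hasDerivAt
    (f := fun θ => Real.sin θ ^ (2 * k + 1) * Real.cos θ * rootFactor r θ)]
  · simp
  · intro θ _
    have h := (((Real.hasDerivAt_sin θ).fun_pow (2 * k + 1)).fun_mul
      (Real.hasDerivAt_cos θ)).fun_mul (hasDerivAt_rootFactor_angle hr θ)
    have hp := rootFactor_pos hr θ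
    refine h.congr_deriv ?_
    rw [exactForm, ← rootFactor_sq hr, add_tsub_cancel_right]
    push_cast
    field_simp
    ring
  · exact (continuous_exactForm k hr).intervalIntegrable _ _

/-- The moment `∫ u ^ (2 k) w du` of the oval `w ^ 2 = (1/4 - u ^ 2) ^ 2 - (1/4 - r) ^ 2`, in the
angular coordinate `u = √r sin θ`. -/
noncomputable def ovalMoment (k : ℕ) (r : ℝ) : ℝ :=
  r ^ (k + 1) * ∫ θ in -(Real.pi / 2)..Real.pi / 2,
    Real.sin θ ^ (2 * k) * Real.cos θ ^ 2 * rootFactor r θ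

/-- The period `∫ u ^ (2 k) / w du` of the same oval. -/
noncomputable def ovalPeriod (k : ℕ) (r : ℝ) : ℝ :=
  r ^ k * ∫ θ in -(Real.pi / 2)..Real.pi / 2, Real.sin θ ^ (2 * k) / rootFactor r θ

lemma integral_linear_combination {f g u v : ℝ → ℝ} (hf : Continuous f) (hg : Continuous g)
    (hu : Continuous u) (a b c x y : ℝ)
    (h : ∀ θ, a * f θ + b * g θ + c * u θ = v θ) :
    a * (∫ θ in x..y, f θ) + b * (∫ θ in x..y, g θ) + c * (∫ θ in x..y, u θ) =
      ∫ θ in x..y, v θ := by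
  simp_rw [← h]
  rw [intervalIntegral.integral_add, intervalIntegral.integral_add]
  · simp
  all_goals exact Continuous.intervalIntegrable (by fun_prop) _ _

lemma hasDerivAt_ovalMoment (k : ℕ) {r : ℝ} (hr : r < 1 / 4) :
    HasDerivAt (ovalMoment k) ((1 / 4 - r) * ovalPeriod k r) r := by
  have hφ : Continuous fun θ : ℝ => Real.sin θ ^ (2 * k) * Real.cos θ ^ 2 := by fun_prop
  refine ((hasDerivAt_pow (k + 1) r).fun_mul
    (hasDerivAt_integral_mul_rootFactor hφ hr)).congr_deriv ?_
  have key := integral_linear_combination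
    (f := fun θ => Real.sin θ ^ (2 * k) * Real.cos θ ^ 2 * rootFactor r θ)
    (g := fun θ => Real.sin θ ^ (2 * k) * Real.cos θ ^ 2 *
      (-(1 + Real.sin θ ^ 2) / (2 * rootFactor r θ)))
    (u := fun θ => Real.sin θ ^ (2 * k) / rootFactor r θ)
    (hφ.mul (continuous_rootFactor r)) ?_ (continuous_div_rootFactor (by fun_prop) hr)
    (k + 1) r (-(1 / 4 - r)) (-(Real.pi / 2)) (Real.pi / 2)
    (v := fun θ => 1 / 2 * exactForm k r θ) ?_
  · rw [intervalIntegral.integral_const_mul, integral_exactForm k hr] at key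
    simp only [ovalPeriod, add_tsub_cancel_right, Nat.cast_add, Nat.cast_one]
    linear_combination r ^ k * key
  · refine hφ.mul (Continuous.div (by fun_prop)
      (continuous_const.mul (continuous_rootFactor r)) fun θ => ?_)
    have := rootFactor_pos hr θ
    positivity
  · intro θ
    have hp := rootFactor_pos hr θ
    have hs := rootFactor_sq hr θ
    unfold exactForm
    field_simp
    rw [hs, Real.cos_sq']
    ring

lemma ovalMoment_zero_eq {r : ℝ} (hr : r < 1 / 4) :
    3 * ovalMoment 0 r = 2 * (r / 2 - r ^ 2) * ovalPeriod 0 r - ovalPeriod 1 r / 2 := by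
  have key := integral_linear_combination
    (f := fun θ => Real.sin θ ^ (2 * 0) * Real.cos θ ^ 2 * rootFactor r θ)
    (g := fun θ => Real.sin θ ^ (2 * 0) / rootFactor r θ)
    (u := fun θ => Real.sin θ ^ (2 * 1) / rootFactor r θ)
    (.mul (by fun_prop) (continuous_rootFactor r)) (continuous_div_rootFactor (by fun_prop) hr)
    (continuous_div_rootFactor (by fun_prop) hr)
    3 (-(1 - 2 * r)) (1 / 2) (-(Real.pi / 2)) (Real.pi / 2)
    (v := exactForm 0 r) ?_
  · rw [integral_exactForm 0 hr] at key
    simp only [ovalPeriod, ovalMoment]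
    linear_combination r * key
  · intro θ
    have hp := rootFactor_pos hr θ
    have hs := rootFactor_sq hr θ
    unfold exactForm
    field_simp
    rw [hs, Real.cos_sq']
    push_cast
    ring

lemma ovalMoment_one_eq {r : ℝ} (hr : r < 1 / 4) :
    5 * ovalMoment 1 r - ovalMoment 0 r / 4 = -2 * (1 / 4 - r) ^ 2 * ovalPeriod 1 r := by
  have key := integral_linear_combination
    (f := fun θ => Real.sin θ ^ (2 * 1) * Real.cos θ ^ 2 * rootFactor r θ)
    (g := fun θ => Real.sin θ ^ (2 * 0) * Real.cos θ ^ 2 * rootFactor r θ)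
    (u := fun θ => Real.sin θ ^ (2 * 1) / rootFactor r θ)
    (.mul (by fun_prop) (continuous_rootFactor r)) (.mul (by fun_prop) (continuous_rootFactor r))
    (continuous_div_rootFactor (by fun_prop) hr)
    (5 * r ^ 2) (-r / 4) (2 * (1 / 4 - r) ^ 2 * r) (-(Real.pi / 2)) (Real.pi / 2)
    (v := fun θ => r ^ 2 * exactForm 1 r θ - r / 4 * exactForm 0 r θ) ?_
  · rw [intervalIntegral.integral_sub
      (((continuous_exactForm 1 hr).const_mul _).intervalIntegrable _ _)
      (((continuous_exactForm 0 hr).const_mul _).intervalIntegrable _ _),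
      intervalIntegral.integral_const_mul, intervalIntegral.integral_const_mul,
      integral_exactForm 1 hr, integral_exactForm 0 hr] at key
    simp only [ovalPeriod, ovalMoment]
    linear_combination key
  · intro θ
    have hp := rootFactor_pos hr θ
    have hs := rootFactor_sq hr θ
    unfold exactForm
    field_simp
    rw [hs, Real.cos_sq']
    push_cast
    ring

lemma Δset_subset {t : ℝ} (ht : 0 < t) : Δset t ⊆ Ioo 0 1 ×ˢ Ioo 0 1 := by
  rintro ⟨x, y⟩ ⟨hx, hy, h⟩
  dsimp only at hx hy h
  have : 0 < 1 - x - y := pos_of_mul_pos_right (ht.trans_le h) (by positivity)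
  exact ⟨⟨hx, by linarith⟩, ⟨hy, by linarith⟩⟩

lemma measurableSet_Δset (t : ℝ) : MeasurableSet (Δset t) := by
  unfold Δset
  measurability

/-- Length of the vertical slices of `Δset t`. -/
lemma mul_volume_slice {t x : ℝ} (ht : 0 < t) (hx : x ∈ Ioo (0 : ℝ) 1) :
    x * volume.real (Prod.mk x ⁻¹' Δset t) = √((x * (1 - x)) ^ 2 - 4 * t) := by
  obtain ⟨hx0, hx1⟩ := hx
  have key : ∀ y, y ∈ Prod.mk x ⁻¹' Δset t ↔
      (x * (2 * y - (1 - x))) ^ 2 ≤ (x * (1 - x)) ^ 2 - 4 * t := by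
    intro y
    change 0 < x ∧ 0 < y ∧ t ≤ x ^ 2 * y * (1 - x - y) ↔ _
    refine ⟨fun h => by linarith [h.2.2], fun h => ?_⟩
    have h' : t ≤ x ^ 2 * y * (1 - x - y) := by linarith
    refine ⟨hx0, ?_, h'⟩
    by_contra! hy
    have : x ^ 2 * y * (1 - x - y) ≤ 0 :=
      mul_nonpos_of_nonpos_of_nonneg (mul_nonpos_of_nonneg_of_nonpos (sq_nonneg x) hy) (by linarith)
    linarith
  rcases lt_or_ge ((x * (1 - x)) ^ 2 - 4 * t) 0 with h | h
  · have : Prod.mk x ⁻¹' Δset t = ∅ := by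
      ext y
      rw [key]
      simpa using h.trans_le (sq_nonneg _)
    rw [this, Real.sqrt_eq_zero_of_nonpos h.le]
    simp
  · set w := √((x * (1 - x)) ^ 2 - 4 * t)
    have hw : 0 ≤ w := Real.sqrt_nonneg _
    have : Prod.mk x ⁻¹' Δset t = Icc ((1 - x - w / x) / 2) ((1 - x + w / x) / 2) := by
      ext y
      rw [key, ← Real.sq_sqrt h, sq_le_sq, abs_of_nonneg hw, abs_le, mem_Icc]
      have hv : w = x * (w / x) := by field_simp
      generalize w / x = v at hv
      rw [hv, ← mul_neg, mul_le_mul_iff_right₀ hx0, mul_le_mul_iff_right₀ hx0]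
      constructor <;> rintro ⟨h, h'⟩ <;> constructor <;> linarith
    rw [this, Real.volume_real_Icc_of_le]
    · field_simp
      ring
    · have := div_nonneg hw hx0.le
      linarith

lemma integral_Δset_pow (n : ℕ) {t : ℝ} (ht : 0 < t) :
    ∫ z in Δset t, z.1 ^ (n + 1) = ∫ x in (0 : ℝ)..1, x ^ n * √((x * (1 - x)) ^ 2 - 4 * t) := by
  have hint : IntegrableOn (fun z : ℝ × ℝ => z.1 ^ (n + 1)) (Δset t) :=
    (ContinuousOn.integrableOn_compact (isCompact_Icc.prod isCompact_Icc)
      (by fun_prop : ContinuousOn (fun z : ℝ × ℝ => z.1 ^ (n + 1))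
        (Icc (0 : ℝ) 1 ×ˢ Icc (0 : ℝ) 1))).mono_set
      ((Δset_subset ht).trans (prod_mono Ioo_subset_Icc_self Ioo_subset_Icc_self))
  rw [← integral_indicator (measurableSet_Δset t), Measure.volume_eq_prod,
    integral_prod _ ((integrable_indicator_iff (measurableSet_Δset t)).2 hint),
    intervalIntegral.integral_of_le zero_le_one, integral_Ioc_eq_integral_Ioo,
    ← integral_indicator measurableSet_Ioo]
  congr 1 with x
  have hs : MeasurableSet (Prod.mk x ⁻¹' Δset t) := measurable_prodMk_left (measurableSet_Δset t)
  have h1 : ∀ y, (Δset t).indicator (fun z : ℝ × ℝ => z.1 ^ (n + 1)) (x, y) =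
      (Prod.mk x ⁻¹' Δset t).indicator (fun _ => x ^ (n + 1)) y := fun y => rfl
  simp_rw [h1]
  rw [integral_indicator_const _ hs, smul_eq_mul]
  by_cases hx : x ∈ Ioo (0 : ℝ) 1
  · rw [indicator_of_mem hx, ← mul_volume_slice ht hx]
    ring
  · have : Prod.mk x ⁻¹' Δset t = ∅ :=
      eq_empty_of_forall_notMem fun y hy => hx (Δset_subset ht hy).1
    rw [indicator_of_notMem hx, this]
    simp

/-- The parametrization of the oval by an angle. -/
lemma integral_pow_mul_sqrt (n : ℕ) {t r : ℝ} (hr : 0 < r) (hr' : r < 1 / 4)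
    (htr : 4 * t = (1 / 4 - r) ^ 2) :
    ∫ x in (0 : ℝ)..1, x ^ n * √((x * (1 - x)) ^ 2 - 4 * t) =
      ∫ θ in -(Real.pi / 2)..Real.pi / 2,
        (1 / 2 + √r * Real.sin θ) ^ n * (r * Real.cos θ ^ 2 * rootFactor r θ) := by
  set q := √r
  have hq : q ^ 2 = r := Real.sq_sqrt hr.le
  have hq0 : 0 < q := Real.sqrt_pos.2 hr
  have hq1 : q < 1 / 2 := by nlinarith
  set F : ℝ → ℝ := fun x => x ^ n * √((x * (1 - x)) ^ 2 - 4 * t)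
  have hF : Continuous F := by fun_prop
  have hfac : ∀ x, (x * (1 - x)) ^ 2 - 4 * t =
      (r - (x - 1 / 2) ^ 2) * (1 / 2 - r - (x - 1 / 2) ^ 2) := fun x => by rw [htr]; ring
  have hzero : ∀ x, 0 ≤ x → x ≤ 1 → r ≤ (x - 1 / 2) ^ 2 → F x = 0 := by
    intro x h0 h1 hx
    have : √((x * (1 - x)) ^ 2 - 4 * t) = 0 := by
      refine Real.sqrt_eq_zero_of_nonpos ?_
      rw [hfac]
      exact mul_nonpos_of_nonpos_of_nonneg (by linarith) (by nlinarith)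
    simp [F, this]
  have hleft : ∫ x in (0 : ℝ)..(1 / 2 - q), F x = 0 := by
    rw [intervalIntegral.integral_congr (g := fun _ => 0)]
    · simp
    · intro x hx
      rw [uIcc_of_le (by linarith)] at hx
      exact hzero x hx.1 (by linarith [hx.2]) (by nlinarith [hx.2])
  have hright : ∫ x in (1 / 2 + q)..1, F x = 0 := by
    rw [intervalIntegral.integral_congr (g := fun _ => 0)]
    · simp
    · intro x hx
      rw [uIcc_of_le (by linarith)] at hx
      exact hzero x (by linarith [hx.1]) hx.2 (by nlinarith [hx.1])
  have hsplit : ∫ x in (0 : ℝ)..1, F x = ∫ x in (1 / 2 - q)..(1 / 2 + q), F x := by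
    rw [← intervalIntegral.integral_add_adjacent_intervals (b := 1 / 2 - q)
      (hF.intervalIntegrable _ _) (hF.intervalIntegrable _ _),
      ← intervalIntegral.integral_add_adjacent_intervals (a := 1 / 2 - q) (b := 1 / 2 + q)
      (hF.intervalIntegrable _ _) (hF.intervalIntegrable _ _), hleft, hright]
    ring
  have hsub := intervalIntegral.integral_comp_mul_deriv (a := -(Real.pi / 2)) (b := Real.pi / 2)
    (f := fun θ => 1 / 2 + q * Real.sin θ) (f' := fun θ => q * Real.cos θ) (g := F)
    (fun θ _ => ((Real.hasDerivAt_sin θ).const_mul q).const_add (1 / 2)) (by fun_prop) hF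
  simp only [Real.sin_neg, Real.sin_pi_div_two, mul_neg, mul_one, ← sub_eq_add_neg] at hsub
  rw [hsplit, ← hsub]
  refine intervalIntegral.integral_congr fun θ hθ => ?_
  rw [uIcc_of_le (by linarith [Real.pi_pos])] at hθ
  have hcos := Real.cos_nonneg_of_mem_Icc hθ
  have : √(((1 / 2 + q * Real.sin θ) * (1 - (1 / 2 + q * Real.sin θ))) ^ 2 - 4 * t) =
      q * Real.cos θ * rootFactor r θ := by
    rw [hfac, ← Real.sqrt_sq (mul_nonneg hq0.le hcos), rootFactor, ← Real.sqrt_mul (sq_nonneg _)]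
    congr 1
    rw [mul_pow, Real.cos_sq', ← hq]
    ring
  simp only [Function.comp_apply, F, this]
  rw [← hq]
  ring

lemma integral_odd_eq_zero {f : ℝ → ℝ} (hf : ∀ x, f (-x) = -f x) (a : ℝ) :
    ∫ x in -a..a, f x = 0 := by
  have h := intervalIntegral.integral_comp_neg (a := -a) (b := a) f
  simp only [hf, intervalIntegral.integral_neg, neg_neg] at h
  linarith

lemma rootFactor_neg (r θ : ℝ) : rootFactor r (-θ) = rootFactor r θ := by simp [rootFactor]

lemma J2_eq_ovalMoment {t r : ℝ} (hr : 0 < r) (hr' : r < 1 / 4) (htr : 4 * t = (1 / 4 - r) ^ 2) :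
    J2 t = ovalMoment 0 r / 2 := by
  have ht : 0 < t := by nlinarith
  have h : J2 t = ∫ z in Δset t, z.1 ^ (1 + 1) := by simp [J2, Iab]
  have hodd := integral_odd_eq_zero
    (f := fun θ => Real.sin θ * Real.cos θ ^ 2 * rootFactor r θ)
    (fun θ => by simp [rootFactor_neg]) (Real.pi / 2)
  have key := integral_linear_combination
    (f := fun θ => Real.sin θ * Real.cos θ ^ 2 * rootFactor r θ)
    (g := fun θ => Real.sin θ ^ (2 * 0) * Real.cos θ ^ 2 * rootFactor r θ)
    (u := fun _ => 0)
    (.mul (by fun_prop) (continuous_rootFactor r)) (.mul (by fun_prop) (continuous_rootFactor r))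
    continuous_const (r * √r) (r / 2) 0 (-(Real.pi / 2)) (Real.pi / 2)
    (v := fun θ => (1 / 2 + √r * Real.sin θ) ^ 1 * (r * Real.cos θ ^ 2 * rootFactor r θ))
    (fun θ => by ring)
  rw [h, integral_Δset_pow 1 ht, integral_pow_mul_sqrt 1 hr hr' htr, ← key, hodd, ovalMoment]
  simp
  ring

lemma J3_eq_ovalMoment {t r : ℝ} (hr : 0 < r) (hr' : r < 1 / 4) (htr : 4 * t = (1 / 4 - r) ^ 2) :
    J3 t = ovalMoment 1 r + ovalMoment 0 r / 4 := by
  have ht : 0 < t := by nlinarith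
  have h : J3 t = ∫ z in Δset t, z.1 ^ (2 + 1) := by
    simp only [J3, Iab, zpow_zero, mul_one]
    norm_cast
  have hodd := integral_odd_eq_zero
    (f := fun θ => Real.sin θ * Real.cos θ ^ 2 * rootFactor r θ)
    (fun θ => by simp [rootFactor_neg]) (Real.pi / 2)
  have key := integral_linear_combination
    (f := fun θ => Real.sin θ * Real.cos θ ^ 2 * rootFactor r θ)
    (g := fun θ => Real.sin θ ^ (2 * 0) * Real.cos θ ^ 2 * rootFactor r θ)
    (u := fun θ => Real.sin θ ^ (2 * 1) * Real.cos θ ^ 2 * rootFactor r θ)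
    (.mul (by fun_prop) (continuous_rootFactor r)) (.mul (by fun_prop) (continuous_rootFactor r))
    (.mul (by fun_prop) (continuous_rootFactor r))
    (r * √r) (r / 4) (r * √r ^ 2) (-(Real.pi / 2)) (Real.pi / 2)
    (v := fun θ => (1 / 2 + √r * Real.sin θ) ^ 2 * (r * Real.cos θ ^ 2 * rootFactor r θ))
    (fun θ => by ring)
  rw [h, integral_Δset_pow 2 ht, integral_pow_mul_sqrt 2 hr hr' htr, ← key, hodd,
    Real.sq_sqrt hr.le, ovalMoment, ovalMoment]
  ring

lemma ovalMoment_zero_pos {r : ℝ} (hr : 0 < r) (hr' : r < 1 / 4) : 0 < ovalMoment 0 r := by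
  refine mul_pos (by positivity) (intervalIntegral.intervalIntegral_pos_of_pos_on ?_ ?_ ?_)
  · exact (Continuous.mul (by fun_prop) (continuous_rootFactor r)).intervalIntegrable _ _
  · intro θ hθ
    have := Real.cos_pos_of_mem_Ioo hθ
    have := rootFactor_pos hr' θ
    rw [mul_zero, pow_zero]
    positivity
  · linarith [Real.pi_pos]

lemma ovalParameter_bounds {t : ℝ} (ht : t ∈ Ioo (0 : ℝ) (1 / 64)) :
    0 < 1 / 4 - 2 * √t ∧ 1 / 4 - 2 * √t < 1 / 4 ∧ 4 * t = (1 / 4 - (1 / 4 - 2 * √t)) ^ 2 := by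
  have h0 : 0 < √t := Real.sqrt_pos.2 ht.1
  have h1 : √t ^ 2 = t := Real.sq_sqrt ht.1.le
  have h2 := ht.2
  refine ⟨?_, by linarith, by linarith⟩
  nlinarith

lemma J2_pos {t : ℝ} (ht : t ∈ Ioo (0 : ℝ) (1 / 64)) : 0 < J2 t := by
  obtain ⟨h1, h2, h3⟩ := ovalParameter_bounds ht
  rw [J2_eq_ovalMoment h1 h2 h3]
  exact half_pos (ovalMoment_zero_pos h1 h2)

lemma hasDerivAt_ovalMoment_comp (k : ℕ) {t : ℝ} (ht : t ∈ Ioo (0 : ℝ) (1 / 64)) :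
    HasDerivAt (fun t => ovalMoment k (1 / 4 - 2 * √t)) (-2 * ovalPeriod k (1 / 4 - 2 * √t)) t := by
  obtain ⟨h1, h2, h3⟩ := ovalParameter_bounds ht
  have h := (hasDerivAt_ovalMoment k h2).comp t
    (((Real.hasDerivAt_sqrt ht.1.ne').const_mul 2).const_sub (1 / 4))
  refine h.congr_deriv ?_
  have : 0 < √t := Real.sqrt_pos.2 ht.1
  field_simp
  ring

/-- The Picard–Fuchs equation for `J2`. -/
lemma hasDerivAt_J2 {t : ℝ} (ht : t ∈ Ioo (0 : ℝ) (1 / 64)) :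
    HasDerivAt J2 (((-192 * t - 6) * J2 t + 10 * J3 t) / (4 * t * (1 - 64 * t))) t := by
  obtain ⟨h1, h2, h3⟩ := ovalParameter_bounds ht
  have hJ : J2 =ᶠ[nhds t] fun t => ovalMoment 0 (1 / 4 - 2 * √t) / 2 := by
    filter_upwards [isOpen_Ioo.mem_nhds ht] with s hs
    obtain ⟨h1, h2, h3⟩ := ovalParameter_bounds hs
    exact J2_eq_ovalMoment h1 h2 h3
  refine (((hasDerivAt_ovalMoment_comp 0 ht).div_const 2).congr_of_eventuallyEq hJ).congr_deriv ?_
  have e0 := ovalMoment_zero_eq h2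
  have e1 := ovalMoment_one_eq h2
  rw [J2_eq_ovalMoment h1 h2 h3, J3_eq_ovalMoment h1 h2 h3]
  generalize 1 / 4 - 2 * √t = r at *
  obtain ⟨ht0, ht1⟩ := ht
  have : 0 < 1 - 64 * t := by linarith
  rw [eq_div_iff (by positivity)]
  obtain rfl : t = (1 / 4 - r) ^ 2 / 4 := by linarith
  linear_combination 32 * ((1 / 4 - r) ^ 2 / 4) * e0 - 2 * e1

/-- The Picard–Fuchs equation for `J3`. -/
lemma hasDerivAt_J3 {t : ℝ} (ht : t ∈ Ioo (0 : ℝ) (1 / 64)) :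
    HasDerivAt J3 (((96 * t - 6) * J2 t + (10 - 320 * t) * J3 t) / (4 * t * (1 - 64 * t))) t := by
  obtain ⟨h1, h2, h3⟩ := ovalParameter_bounds ht
  have hJ : J3 =ᶠ[nhds t] fun t =>
      ovalMoment 1 (1 / 4 - 2 * √t) + ovalMoment 0 (1 / 4 - 2 * √t) / 4 := by
    filter_upwards [isOpen_Ioo.mem_nhds ht] with s hs
    obtain ⟨h1, h2, h3⟩ := ovalParameter_bounds hs
    exact J3_eq_ovalMoment h1 h2 h3
  refine (((hasDerivAt_ovalMoment_comp 1 ht).add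
    ((hasDerivAt_ovalMoment_comp 0 ht).div_const 4)).congr_of_eventuallyEq hJ).congr_deriv ?_
  have e0 := ovalMoment_zero_eq h2
  have e1 := ovalMoment_one_eq h2
  rw [J2_eq_ovalMoment h1 h2 h3, J3_eq_ovalMoment h1 h2 h3]
  generalize 1 / 4 - 2 * √t = r at *
  obtain ⟨ht0, ht1⟩ := ht
  have : 0 < 1 - 64 * t := by linarith
  rw [eq_div_iff (by positivity)]
  obtain rfl : t = (1 / 4 - r) ^ 2 / 4 := by linarith
  linear_combination 16 * ((1 / 4 - r) ^ 2 / 4) * e0 +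
    (-2 + 64 * ((1 / 4 - r) ^ 2 / 4)) * e1

/-- Existence of an integrating factor for `g' = r + k g`. -/
lemma exists_integrating_factor {k : ℝ → ℝ} {x y : ℝ} (hxy : x < y)
    (hk : ContinuousOn k (Icc x y)) :
    ∃ E : ℝ → ℝ, (∀ t, 0 < E t) ∧ ∀ t ∈ Icc x y, HasDerivAt E (-k t * E t) t := by
  have hc : Continuous (IccExtend hxy.le ((Icc x y).domRestrict k)) :=
    (continuousOn_iff_continuous_domRestrict.1 hk).Icc_extend'
  refine ⟨fun t => Real.exp (-∫ s in x..t, IccExtend hxy.le ((Icc x y).domRestrict k) s),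
    fun t => Real.exp_pos _, fun t ht => ?_⟩
  refine (hc.integral_hasStrictDerivAt x t).hasDerivAt.neg.exp.congr_deriv ?_
  rw [IccExtend_of_mem _ _ ht, domRestrict_apply, Pi.neg_apply, mul_comm]

lemma hasDerivAt_mul_integrating_factor {g r k E : ℝ → ℝ} {t : ℝ}
    (hg : HasDerivAt g (r t + k t * g t) t) (hE : HasDerivAt E (-k t * E t) t) :
    HasDerivAt (fun t => g t * E t) (r t * E t) t :=
  (hg.fun_mul hE).congr_deriv (by ring)

/-- Rolle's theorem for inhomogeneous linear equations. -/
lemma exists_source_eq_zero {g r k : ℝ → ℝ} {x y : ℝ} (hxy : x < y)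
    (hk : ContinuousOn k (Icc x y)) (hg : ∀ t ∈ Icc x y, HasDerivAt g (r t + k t * g t) t)
    (hx : g x = 0) (hy : g y = 0) : ∃ c ∈ Ioo x y, r c = 0 := by
  obtain ⟨E, hE, hE'⟩ := exists_integrating_factor hxy hk
  have hd := fun t ht => hasDerivAt_mul_integrating_factor (hg t ht) (hE' t ht)
  obtain ⟨c, hc, h⟩ := exists_hasDerivAt_eq_zero hxy
    (fun t ht => (hd t ht).continuousAt.continuousWithinAt) (by simp [hx, hy])
    (fun t ht => hd t (Ioo_subset_Icc_self ht))
  exact ⟨c, hc, (mul_eq_zero.1 h).resolve_right (hE c).ne'⟩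

lemma eq_zero_of_linear_homogeneous {g k : ℝ → ℝ} {x y : ℝ} (hxy : x < y)
    (hk : ContinuousOn k (Icc x y)) (hg : ∀ t ∈ Icc x y, HasDerivAt g (k t * g t) t)
    (hx : g x = 0) : g y = 0 := by
  obtain ⟨E, hE, hE'⟩ := exists_integrating_factor hxy hk
  have hd : ∀ t ∈ Icc x y, HasDerivAt (fun t => g t * E t) 0 t := fun t ht => by
    simpa using hasDerivAt_mul_integrating_factor (r := fun _ => 0)
      (by simpa using hg t ht) (hE' t ht)
  have h := constant_of_has_deriv_right_zero
    (fun t ht => (hd t ht).continuousAt.continuousWithinAt)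
    (fun t ht => (hd t (Ico_subset_Icc_self ht)).hasDerivWithinAt) y (right_mem_Icc.2 hxy.le)
  rw [hx, zero_mul] at h
  exact (mul_eq_zero.1 h).resolve_right (hE y).ne'

open Polynomial in
/-- The contact polynomial of the curve `a + b q = 0` with the Riccati equation satisfied by
`q = J3 / J2`. -/
noncomputable def contactPoly (a b : ℝ[X]) : ℝ[X] :=
  -(C 4 * X - C 256 * X ^ 2) * wronskian a b + (C 96 * X - C 6) * b ^ 2
    - (C 16 - C 128 * X) * (a * b) - C 10 * a ^ 2

open Polynomial in
lemma natDegree_contactPoly_le {a b : ℝ[X]} {m : ℕ} (ha : a.natDegree ≤ m) (hb : b.natDegree ≤ m) :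
    (contactPoly a b).natDegree ≤ 2 * m + 1 := by
  have hw : ((C 4 * X - C 256 * X ^ 2 : ℝ[X]) * wronskian a b).natDegree ≤ 2 * m + 1 := by
    by_cases h : wronskian a b = 0
    · simp [h]
    · have h1 := natDegree_wronskian_lt_add h
      have h2 : (C 4 * X - C 256 * X ^ 2 : ℝ[X]).natDegree ≤ 2 := by compute_degree
      have := natDegree_mul_le_of_le h2 (le_refl (wronskian a b).natDegree)
      omega
  have hbb : ((C 96 * X - C 6 : ℝ[X]) * b ^ 2).natDegree ≤ 2 * m + 1 := by
    have h2 : (C 96 * X - C 6 : ℝ[X]).natDegree ≤ 1 := by compute_degree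
    have := natDegree_mul_le_of_le h2 (natDegree_pow_le_of_le 2 hb)
    omega
  have hab : ((C 16 - C 128 * X : ℝ[X]) * (a * b)).natDegree ≤ 2 * m + 1 := by
    have h2 : (C 16 - C 128 * X : ℝ[X]).natDegree ≤ 1 := by compute_degree
    have := natDegree_mul_le_of_le h2 (natDegree_mul_le_of_le ha hb)
    omega
  have haa : (C 10 * a ^ 2 : ℝ[X]).natDegree ≤ 2 * m + 1 := by
    have := (natDegree_C_mul_le (10 : ℝ) (a ^ 2)).trans (natDegree_pow_le_of_le 2 ha)
    omega
  rw [contactPoly, neg_mul]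
  refine (natDegree_sub_le _ _).trans (max_le ((natDegree_sub_le _ _).trans (max_le ?_ hab)) haa)
  exact natDegree_add_le_of_degree_le ((natDegree_neg _).trans_le hw) hbb

/-- The quotient `(a J₂ + b J₃) / (b J₂)`. -/
noncomputable def reducedRatio (a b : Polynomial ℝ) (t : ℝ) : ℝ :=
  a.eval t / b.eval t + J3 t / J2 t

lemma reducedRatio_eq_zero_iff {a b : Polynomial ℝ} {t : ℝ} (ht : t ∈ Ioo (0 : ℝ) (1 / 64))
    (hbt : b.eval t ≠ 0) :
    reducedRatio a b t = 0 ↔ a.eval t * J2 t + b.eval t * J3 t = 0 := by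
  have := (J2_pos ht).ne'
  rw [reducedRatio, div_add_div _ _ hbt this, div_eq_zero_iff]
  simp [hbt, this]

/-- Linear coefficient in the equation satisfied by `reducedRatio`. -/
noncomputable def ratioCoeff (a b : Polynomial ℝ) (t : ℝ) : ℝ :=
  (16 - 128 * t - 10 * (reducedRatio a b t - 2 * (a.eval t / b.eval t))) / (4 * t * (1 - 64 * t))

lemma hasDerivAt_reducedRatio {a b : Polynomial ℝ} {t : ℝ} (ht : t ∈ Ioo (0 : ℝ) (1 / 64))
    (hbt : b.eval t ≠ 0) :
    HasDerivAt (reducedRatio a b)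
      ((contactPoly a b).eval t / (4 * t * (1 - 64 * t) * b.eval t ^ 2) +
        ratioCoeff a b t * reducedRatio a b t) t := by
  have hJ := (J2_pos ht).ne'
  refine (((a.hasDerivAt t).div (b.hasDerivAt t) hbt).add
    ((hasDerivAt_J3 ht).div (hasDerivAt_J2 ht) hJ)).congr_deriv ?_
  have h0 : t ≠ 0 := ht.1.ne'
  have h1 : 1 - 64 * t ≠ 0 := by linarith [ht.2]
  simp only [ratioCoeff, reducedRatio, contactPoly, Polynomial.wronskian, Polynomial.eval_add,
    Polynomial.eval_sub, Polynomial.eval_mul, Polynomial.eval_neg, Polynomial.eval_C,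
    Polynomial.eval_X, Polynomial.eval_pow]
  obtain ⟨e, he⟩ : ∃ e, e = 1 - 64 * t := ⟨_, rfl⟩
  rw [← he] at h1 ⊢
  field_simp
  rw [he]
  ring

lemma continuousOn_ratioCoeff {a b : Polynomial ℝ} {s : Set ℝ} (hs : s ⊆ Ioo (0 : ℝ) (1 / 64))
    (hb : ∀ t ∈ s, b.eval t ≠ 0) : ContinuousOn (ratioCoeff a b) s := by
  have h : ContinuousOn (reducedRatio a b) s := fun t ht =>
    (hasDerivAt_reducedRatio (hs ht) (hb t ht)).continuousAt.continuousWithinAt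
  refine ContinuousOn.div (.sub (by fun_prop) (.mul (by fun_prop) (h.sub (.mul (by fun_prop)
    (a.continuousOn.div b.continuousOn hb))))) (by fun_prop) fun t ht => ?_
  have h0 := (hs ht).1
  have h1 := (hs ht).2
  exact mul_ne_zero (by linarith) (by linarith)

/-- A set of reals separated by the roots of a nonzero polynomial. -/
lemma finite_and_ncard_le_of_interleaved {Z : Set ℝ} {p : Polynomial ℝ} (hp : p ≠ 0)
    (h : ∀ x ∈ Z, ∀ y ∈ Z, x < y → ∃ c ∈ Ioo x y, p.eval c = 0) :
    Z.Finite ∧ Z.ncard ≤ p.natDegree + 1 := by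
  have key : ∀ S : Finset ℝ, ↑S ⊆ Z → S.card ≤ p.natDegree + 1 := by
    intro S hS
    have h1 : S.card ≤ p.roots.toFinset.card + 1 :=
      Finset.card_le_of_interleaved fun x hx y hy hxy _ => by
        obtain ⟨c, hc, h0⟩ := h x (hS hx) y (hS hy) hxy
        exact ⟨c, by simpa [hp] using h0, hc.1, hc.2⟩
    have h2 := p.roots.toFinset_card_le.trans p.card_roots'
    omega
  have hfin : Z.Finite := by
    by_contra hinf
    obtain ⟨S, hS, hc⟩ := Set.Infinite.exists_subset_card_eq hinf (p.natDegree + 2)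
    have := key S hS
    omega
  refine ⟨hfin, ?_⟩
  rw [ncard_eq_toFinset_card Z hfin]
  exact key _ (by simp)

/-- The isolated zeros of `a J₂ + b J₃`. -/
def isolatedZeros (a b : Polynomial ℝ) : Set ℝ :=
  {t | t ∈ Set.Ioo (0 : ℝ) (1 / 64) ∧ a.eval t * J2 t + b.eval t * J3 t = 0 ∧
        ∀ᶠ s in nhdsWithin t (Set.Ioo (0 : ℝ) (1 / 64) \ {t}),
          a.eval s * J2 s + b.eval s * J3 s ≠ 0}

lemma not_isolated_of_eventually_right {f : ℝ → ℝ} {t : ℝ} (ht : t ∈ Ioo (0 : ℝ) (1 / 64))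
    (hf : ∀ᶠ s in nhdsWithin t (Ioi t), f s = 0) :
    ¬ ∀ᶠ s in nhdsWithin t (Set.Ioo (0 : ℝ) (1 / 64) \ {t}), f s ≠ 0 := by
  intro h
  have hle : nhdsWithin t (Ioi t) ≤ nhdsWithin t (Set.Ioo (0 : ℝ) (1 / 64) \ {t}) := by
    refine nhdsWithin_le_iff.2 ?_
    filter_upwards [self_mem_nhdsWithin, mem_nhdsWithin_of_mem_nhds (Iio_mem_nhds ht.2)] with s h1 h2
    exact ⟨⟨ht.1.trans h1, h2⟩, (mem_Ioi.1 h1).ne'⟩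
  obtain ⟨s, h1, h2⟩ := (hf.and (h.filter_mono hle)).exists
  exact h2 h1

lemma eval_ne_zero_of_isCoprime {a b : Polynomial ℝ} (hab : IsCoprime a b) {t : ℝ}
    (ht : t ∈ Ioo (0 : ℝ) (1 / 64)) (h : a.eval t * J2 t + b.eval t * J3 t = 0) :
    b.eval t ≠ 0 := by
  intro hb
  obtain ⟨u, v, huv⟩ := hab
  have hat : a.eval t = 0 := by simpa [hb, (J2_pos ht).ne'] using h
  simpa [hb, hat] using congrArg (Polynomial.eval t) huv

lemma isolatedZeros_of_isCoprime {a b : Polynomial ℝ} (hab : IsCoprime a b) {m : ℕ}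
    (ha : a.natDegree ≤ m) (hb : b.natDegree ≤ m) :
    (isolatedZeros a b).Finite ∧ (isolatedZeros a b).ncard ≤ 3 * m + 2 := by
  have hempty (h : ∀ t, t ∉ isolatedZeros a b) :
      (isolatedZeros a b).Finite ∧ (isolatedZeros a b).ncard ≤ 3 * m + 2 := by
    rw [eq_empty_of_forall_notMem h]
    simp
  by_cases hb0 : b = 0
  · exact hempty fun t ht => eval_ne_zero_of_isCoprime hab ht.1 ht.2.1 (by simp [hb0])
  by_cases hR : contactPoly a b = 0
  · refine hempty fun t ht => not_isolated_of_eventually_right ht.1 ?_ ht.2.2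
    have hbt := eval_ne_zero_of_isCoprime hab ht.1 ht.2.1
    have hnhds : ∀ᶠ s in nhds t, s ∈ Ioo (0 : ℝ) (1 / 64) ∧ b.eval s ≠ 0 :=
      (eventually_mem_set.2 (isOpen_Ioo.mem_nhds ht.1)).and (b.continuous.continuousAt.eventually_ne hbt)
    obtain ⟨ε, hε, hball⟩ := Metric.eventually_nhds_iff_ball.1 hnhds
    filter_upwards [Ioo_mem_nhdsGT (lt_add_of_pos_right t hε)] with y hy
    have hsub : ∀ s ∈ Icc t y, s ∈ Ioo (0 : ℝ) (1 / 64) ∧ b.eval s ≠ 0 := fun s hs =>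
      hball s (by
        rw [Real.ball_eq_Ioo]
        exact ⟨by linarith [hs.1], hs.2.trans_lt hy.2⟩)
    obtain ⟨hy1, hy2⟩ := hsub y (right_mem_Icc.2 hy.1.le)
    rw [← reducedRatio_eq_zero_iff hy1 hy2]
    refine eq_zero_of_linear_homogeneous hy.1
      (continuousOn_ratioCoeff (a := a) (fun s hs => (hsub s hs).1) fun s hs => (hsub s hs).2)
      (fun s hs => ?_) ((reducedRatio_eq_zero_iff ht.1 hbt).2 ht.2.1)
    simpa [hR] using hasDerivAt_reducedRatio (a := a) (hsub s hs).1 (hsub s hs).2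
  · have hp : b * contactPoly a b ≠ 0 := mul_ne_zero hb0 hR
    have hsep : ∀ x ∈ isolatedZeros a b, ∀ y ∈ isolatedZeros a b, x < y →
        ∃ c ∈ Ioo x y, (b * contactPoly a b).eval c = 0 := by
      intro x hx y hy hxy
      by_cases hbc : ∃ c ∈ Ioo x y, b.eval c = 0
      · obtain ⟨c, hc, h⟩ := hbc
        exact ⟨c, hc, by simp [h]⟩
      push Not at hbc
      have hbx := eval_ne_zero_of_isCoprime hab hx.1 hx.2.1
      have hby := eval_ne_zero_of_isCoprime hab hy.1 hy.2.1
      have hsub : Icc x y ⊆ Ioo (0 : ℝ) (1 / 64) := fun s hs =>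
        ⟨hx.1.1.trans_le hs.1, hs.2.trans_lt hy.1.2⟩
      have hbs : ∀ s ∈ Icc x y, b.eval s ≠ 0 := by
        intro s hs
        rcases eq_endpoints_or_mem_Ioo_of_mem_Icc hs with rfl | rfl | h
        exacts [hbx, hby, hbc s h]
      obtain ⟨c, hc, h⟩ := exists_source_eq_zero hxy (continuousOn_ratioCoeff hsub hbs)
        (fun s hs => hasDerivAt_reducedRatio (hsub hs) (hbs s hs))
        ((reducedRatio_eq_zero_iff hx.1 hbx).2 hx.2.1)
        ((reducedRatio_eq_zero_iff hy.1 hby).2 hy.2.1)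
      refine ⟨c, hc, ?_⟩
      have hc' := hsub (Ioo_subset_Icc_self hc)
      have h0 : 4 * c * (1 - 64 * c) * b.eval c ^ 2 ≠ 0 :=
        mul_ne_zero (mul_ne_zero (by linarith [hc'.1]) (by linarith [hc'.2]))
          (pow_ne_zero _ (hbc c hc))
      rw [Polynomial.eval_mul, (div_eq_zero_iff.1 h).resolve_right h0, mul_zero]
    obtain ⟨h1, h2⟩ := finite_and_ncard_le_of_interleaved hp hsep
    have := Polynomial.natDegree_mul_le_of_le hb (natDegree_contactPoly_le ha hb)
    exact ⟨h1, by omega⟩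

lemma isolatedZeros_mul_subset (d a b : Polynomial ℝ) :
    isolatedZeros (d * a) (d * b) ⊆ d.rootSet ℝ ∪ isolatedZeros a b := by
  rintro t ⟨ht, h0, h⟩
  have hfac : ∀ s, (d * a).eval s * J2 s + (d * b).eval s * J3 s =
      d.eval s * (a.eval s * J2 s + b.eval s * J3 s) := fun s => by
    simp only [Polynomial.eval_mul]
    ring
  simp only [hfac] at h0 h
  rcases mul_eq_zero.1 h0 with hd | hab
  · by_cases hd0 : d = 0
    · subst hd0
      exact absurd h (not_isolated_of_eventually_right ht (.of_forall fun s => by simp))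
    · exact .inl ((Polynomial.mem_rootSet_of_ne hd0).2 (by simpa using hd))
  · exact .inr ⟨ht, hab, h.mono fun s => right_ne_zero_of_mul⟩

lemma exists_eq_mul_isCoprime {a b : Polynomial ℝ} (h : a ≠ 0 ∨ b ≠ 0) :
    ∃ d a₁ b₁ : Polynomial ℝ, d ≠ 0 ∧ a = d * a₁ ∧ b = d * b₁ ∧ IsCoprime a₁ b₁ := by
  classical
  set d := EuclideanDomain.gcd a b with hd
  obtain ⟨a₁, ha⟩ : d ∣ a := EuclideanDomain.gcd_dvd_left a b
  obtain ⟨b₁, hb⟩ : d ∣ b := EuclideanDomain.gcd_dvd_right a b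
  have hd0 : d ≠ 0 := fun h0 => by
    rw [h0, zero_mul] at ha hb
    exact h.elim (· ha) (· hb)
  have hbez : d = a * EuclideanDomain.gcdA a b + b * EuclideanDomain.gcdB a b :=
    EuclideanDomain.gcd_eq_gcd_ab a b
  generalize EuclideanDomain.gcdA a b = u at hbez
  generalize EuclideanDomain.gcdB a b = v at hbez
  refine ⟨d, a₁, b₁, hd0, ha, hb, u, v, mul_left_cancel₀ hd0 ?_⟩
  linear_combination -hbez - u * ha - v * hb

lemma isolatedZeros_finite_and_ncard_le {m : ℕ} {a b : Polynomial ℝ} (ha : a.natDegree ≤ m)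
    (hb : b.natDegree ≤ m) :
    (isolatedZeros a b).Finite ∧ (isolatedZeros a b).ncard ≤ 3 * m + 2 := by
  by_cases h0 : a = 0 ∧ b = 0
  · obtain ⟨rfl, rfl⟩ := h0
    have : isolatedZeros 0 0 = ∅ := eq_empty_of_forall_notMem fun t ht =>
      not_isolated_of_eventually_right ht.1 (.of_forall fun s => by simp) ht.2.2
    simp [this]
  obtain ⟨d, a₁, b₁, hd, rfl, rfl, hab⟩ := exists_eq_mul_isCoprime (not_and_or.1 h0)
  have hdeg {p : Polynomial ℝ} (hp : (d * p).natDegree ≤ m) (hp0 : p ≠ 0) :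
      p.natDegree + d.natDegree ≤ m := by
    rwa [Polynomial.natDegree_mul hd hp0, add_comm] at hp
  have hdm : d.natDegree ≤ m := by
    rcases eq_or_ne a₁ 0 with h | h
    · exact (Nat.le_add_left _ _).trans (hdeg hb fun h' => h0 (by simp [h, h']))
    · exact (Nat.le_add_left _ _).trans (hdeg ha h)
  have hdeg' {p : Polynomial ℝ} (hp : (d * p).natDegree ≤ m) : p.natDegree ≤ m - d.natDegree := by
    rcases eq_or_ne p 0 with rfl | h
    · simp
    · exact Nat.le_sub_of_add_le (hdeg hp h)
  obtain ⟨h1, h2⟩ := isolatedZeros_of_isCoprime hab (hdeg' ha) (hdeg' hb)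
  have hfin := (d.rootSet_finite ℝ).union h1
  refine ⟨hfin.subset (isolatedZeros_mul_subset d a₁ b₁), ?_⟩
  have h3 := (ncard_le_ncard (isolatedZeros_mul_subset d a₁ b₁) hfin).trans (ncard_union_le _ _)
  have h4 := d.ncard_rootSet_le ℝ
  omega

theorem zeros_of_combination_J2_J3 (m : ℕ) (a b : Polynomial ℝ)
    (ha : a.natDegree ≤ m) (hb : b.natDegree ≤ m) :
    (({t | t ∈ Set.Ioo (0 : ℝ) (1 / 64) ∧ a.eval t * J2 t + b.eval t * J3 t = 0 ∧
        ∀ᶠ s in nhdsWithin t (Set.Ioo (0 : ℝ) (1 / 64) \ {t}),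
          a.eval s * J2 s + b.eval s * J3 s ≠ 0} : Set ℝ)).Finite ∧
    ({t | t ∈ Set.Ioo (0 : ℝ) (1 / 64) ∧ a.eval t * J2 t + b.eval t * J3 t = 0 ∧
        ∀ᶠ s in nhdsWithin t (Set.Ioo (0 : ℝ) (1 / 64) \ {t}),
          a.eval s * J2 s + b.eval s * J3 s ≠ 0} : Set ℝ).ncard ≤ 3 * m + 2 :=
  isolatedZeros_finite_and_ncard_le ha hb
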